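/- arXiv:1004.1661 — 2 statements merged into one kernel-verified Lean document; each statement's English description precedes it below -/
import Mathlib

section
/- Let P be a convex polygon in ℝ² with all vertices in the integer lattice ℤ². Then the number of lattice points of ℤ² contained in the dilated polygon 4·P is congruent to 1 modulo 2. -/
open scoped Pointwise

/-- A sum over four consecutive periods of a function that is periodic up to a constant is even. -/
lemma even_sum_range_four_mul (f : ℤ → ℤ) (d : ℕ) (e s : ℤ)
    (h : ∀ r < d, ∀ k < 4, f (s + ((d * k + r : ℕ) : ℤ)) = f (s + r) + k * e) :
    Even (∑ i ∈ Finset.range (d * 4), f (s + (i : ℤ))) := by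
  have key : ∀ k : ℕ, k ≤ 4 → ∑ i ∈ Finset.range (d * k), f (s + (i : ℤ)) =
      ∑ j ∈ Finset.range k, ∑ r ∈ Finset.range d, (f (s + r) + j * e) := by
    intro k
    induction k with
    | zero => simp
    | succ k ih =>
      intro hk
      rw [Finset.sum_range_succ, ← ih (by omega), Nat.mul_succ, Finset.sum_range_add]
      congr 1
      exact Finset.sum_congr rfl fun r hr => h r (Finset.mem_range.1 hr) k (by omega)
  rw [key 4 le_rfl]
  simp only [Finset.sum_range_succ _ 3, Finset.sum_range_succ _ 2, Finset.sum_range_succ _ 1,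
    Finset.sum_range_one, Finset.sum_add_distrib, Finset.sum_const, Finset.card_range,
    nsmul_eq_mul]
  exact ⟨2 * (∑ r ∈ Finset.range d, f (s + r)) + 3 * (d * e), by push_cast; ring⟩

lemma sum_Ico_eq_sum_range (f : ℤ → ℤ) (s : ℤ) (n : ℕ) :
    ∑ i ∈ Finset.Ico s (s + n), f i = ∑ i ∈ Finset.range n, f (s + (i : ℤ)) := by
  symm
  refine Finset.sum_bij (fun i _ => s + (i : ℤ)) ?_ ?_ ?_ ?_
  · intro i hi
    have := Finset.mem_range.1 hi
    rw [Finset.mem_Ico]; omega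
  · intro i _ j _ hij
    omega
  · intro b hb
    rw [Finset.mem_Ico] at hb
    exact ⟨(b - s).toNat, by rw [Finset.mem_range]; omega, by omega⟩
  · intros; rfl

lemma ConcaveOn.chord_le {S : Set ℝ} {u : ℝ → ℝ} (hu : ConcaveOn ℝ S u) {s t w : ℝ}
    (hs : s ∈ S) (hw : w ∈ S) (hst : s ≤ t) (htw : t ≤ w) :
    (w - t) * u s + (t - s) * u w ≤ (w - s) * u t := by
  rcases (hst.trans htw).eq_or_lt with h | h
  · obtain rfl : t = s := le_antisymm (htw.trans h.ge) hst
    subst h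
    simp
  · have hd : 0 < w - s := sub_pos.2 h
    have := hu.2 hs hw (div_nonneg (sub_nonneg.2 htw) hd.le)
      (div_nonneg (sub_nonneg.2 hst) hd.le) (by field_simp; ring)
    have ht : ((w - t) / (w - s)) • s + ((t - s) / (w - s)) • w = t := by
      simp only [smul_eq_mul]; field_simp; ring
    rw [ht] at this
    simp only [smul_eq_mul] at this
    calc _ = (w - s) * ((w - t) / (w - s) * u s + (t - s) / (w - s) * u w) := by field_simp
      _ ≤ _ := by gcongr

/-- Let `u` be the upper boundary function of the convex hull of the points `4 • (x v, y v)`.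
Between two lattice points of the form `4 • (x v, y v)` on its graph, the sum of its integer
parts is even. -/
lemma even_sum_Ico_floor {ι : Type*} (V : Finset ι) (x y : ι → ℤ) (A B : ℤ) (u : ℝ → ℝ)
    (hcv : ConcaveOn ℝ (Set.Icc (4 * A : ℝ) (4 * B)) u)
    (hx : ∀ v ∈ V, A ≤ x v ∧ x v ≤ B)
    (hle : ∀ v ∈ V, (4 * y v : ℝ) ≤ u (4 * x v))
    (hsupp : ∀ α β : ℝ, (∀ v ∈ V, (4 * y v : ℝ) ≤ α * (4 * x v) + β) →
      ∀ t ∈ Set.Icc (4 * A : ℝ) (4 * B), u t ≤ α * t + β) (n : ℕ) :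
    ∀ p ∈ V, ∀ q ∈ V, x q - x p = n → u (4 * x p) = 4 * y p → u (4 * x q) = 4 * y q →
      Even (∑ i ∈ Finset.Ico (4 * x p) (4 * x q), ⌊u i⌋) := by
  have hmem : ∀ v ∈ V, (4 * x v : ℝ) ∈ Set.Icc (4 * A : ℝ) (4 * B) := by
    intro v hv
    have h := hx v hv
    constructor
    · exact_mod_cast (by omega : 4 * A ≤ 4 * x v)
    · exact_mod_cast (by omega : 4 * x v ≤ 4 * B)
  induction n using Nat.strong_induction_on with
  | _ n ih =>
  intro p hp q hq hn hup huq
  rcases Nat.eq_zero_or_pos n with rfl | hnpos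
  · rw [show x q = x p by omega]; simp
  obtain ⟨r, hr, hmax⟩ := V.exists_max_image
    (fun v => (x q - x p) * (y v - y p) - (y q - y p) * (x v - x p)) ⟨p, hp⟩
  set D : ℤ := x q - x p with hD
  set E : ℤ := y q - y p with hE
  set g : ℤ := D * (y r - y p) - E * (x r - x p) with hg
  have hDpos : 0 < D := by omega
  have hDR : (0 : ℝ) < D := by exact_mod_cast hDpos
  have hDR' : (D : ℝ) = x q - x p := by rw [hD]; push_cast; ring
  have hER' : (E : ℝ) = y q - y p := by rw [hE]; push_cast; ring
  have hgR : (g : ℝ) = D * (y r - y p) - E * (x r - x p) := by rw [hg]; push_cast; ring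
  have hline : ∀ t ∈ Set.Icc (4 * A : ℝ) (4 * B),
      D * u t ≤ E * (t - 4 * x p) + 4 * D * y p + 4 * g := by
    intro t ht
    have := hsupp (E / D) ((4 * D * y p + 4 * g - 4 * E * x p) / D) (by
      intro v hv
      have h1 : (D * (y v - y p) - E * (x v - x p) : ℝ) ≤ g := by exact_mod_cast hmax v hv
      rw [div_mul_eq_mul_div, ← add_div, le_div_iff₀ hDR]
      linarith) t ht
    rw [div_mul_eq_mul_div, ← add_div, le_div_iff₀ hDR] at this
    linarith
  rcases le_or_gt g 0 with hg0 | hg0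
  · have hg0R : (g : ℝ) ≤ 0 := by exact_mod_cast hg0
    have hfl : ∀ i : ℤ, 4 * x p ≤ i → i ≤ 4 * x q →
        u i = E * (i - 4 * x p) / D + 4 * y p := by
      intro i h1 h2
      have h1R : (4 * x p : ℝ) ≤ i := by exact_mod_cast h1
      have h2R : (i : ℝ) ≤ 4 * x q := by exact_mod_cast h2
      have hc := hcv.chord_le (hmem p hp) (hmem q hq) h1R h2R
      have hl := hline i ⟨(hmem p hp).1.trans h1R, h2R.trans (hmem q hq).2⟩
      rw [hup, huq] at hc
      have hq1 : (x q : ℝ) = x p + D := by linarith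
      have hq2 : (y q : ℝ) = y p + E := by linarith
      rw [hq1, hq2] at hc
      field_simp
      apply le_antisymm <;> nlinarith
    rw [show 4 * x q = 4 * x p + ((n * 4 : ℕ) : ℤ) by push_cast; omega,
      sum_Ico_eq_sum_range (fun i => ⌊u i⌋)]
    refine even_sum_range_four_mul (fun i => ⌊u i⌋) n E (4 * x p) fun r hr k hk => ?_
    have hb : n * k + r ≤ 4 * n := by
      have : n * k ≤ n * 3 := Nat.mul_le_mul_left _ (by omega)
      omega
    have hb' : ((n * k + r : ℕ) : ℤ) ≤ 4 * n := by exact_mod_cast hb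
    rw [hfl _ (by omega) (by omega), hfl _ (by omega) (by omega), ← Int.floor_add_intCast]
    congr 1
    have hDn : (D : ℝ) = n := by exact_mod_cast hn
    rw [hDn] at hDR ⊢
    push_cast
    field_simp
    ring
  · have hg0R : (0 : ℝ) < g := by exact_mod_cast hg0
    have hur : u (4 * x r) = 4 * y r := by
      refine le_antisymm ?_ (hle r hr)
      have := hline _ (hmem r hr)
      refine le_of_mul_le_mul_left ?_ hDR
      linarith
    have hpr : x p < x r := by
      by_contra! hcon
      have h1 : (4 * x r : ℝ) ≤ 4 * x p := by exact_mod_cast (by omega : 4 * x r ≤ 4 * x p)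
      have h2 : (4 * x p : ℝ) ≤ 4 * x q := by exact_mod_cast (by omega : 4 * x p ≤ 4 * x q)
      have hc := hcv.chord_le (hmem r hr) (hmem q hq) h1 h2
      rw [hup, huq, hur] at hc
      rw [hDR', hER'] at hgR
      linarith
    have hrq : x r < x q := by
      by_contra! hcon
      have h1 : (4 * x q : ℝ) ≤ 4 * x r := by exact_mod_cast (by omega : 4 * x q ≤ 4 * x r)
      have h2 : (4 * x p : ℝ) ≤ 4 * x q := by exact_mod_cast (by omega : 4 * x p ≤ 4 * x q)
      have hc := hcv.chord_le (hmem p hp) (hmem r hr) h2 h1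
      rw [hup, huq, hur] at hc
      rw [hDR', hER'] at hgR
      linarith
    rw [← Finset.Ico_union_Ico_eq_Ico (by omega : 4 * x p ≤ 4 * x r)
      (by omega : 4 * x r ≤ 4 * x q),
      Finset.sum_union (Finset.Ico_disjoint_Ico_consecutive _ _ _)]
    exact (ih (x r - x p).toNat (by omega) p hp r hr (by omega) hup hur).add
      (ih (x q - x r).toNat (by omega) r hr q hq (by omega) hur huq)

/-- The sum of the integer parts of the upper boundary function of the convex hull of the points
`4 • (x v, y v)`, over all its integer arguments, is even. -/
lemma even_sum_Icc_floor {ι : Type*} (V : Finset ι) (x y : ι → ℤ) (A B : ℤ) (u : ℝ → ℝ)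
    (hcv : ConcaveOn ℝ (Set.Icc (4 * A : ℝ) (4 * B)) u)
    (hx : ∀ v ∈ V, A ≤ x v ∧ x v ≤ B)
    (hA : ∃ v ∈ V, x v = A) (hB : ∃ v ∈ V, x v = B)
    (hle : ∀ v ∈ V, (4 * y v : ℝ) ≤ u (4 * x v))
    (hsupp : ∀ α β : ℝ, (∀ v ∈ V, (4 * y v : ℝ) ≤ α * (4 * x v) + β) →
      ∀ t ∈ Set.Icc (4 * A : ℝ) (4 * B), u t ≤ α * t + β) :
    Even (∑ i ∈ Finset.Icc (4 * A) (4 * B), ⌊u i⌋) := by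
  classical
  have hAB : A ≤ B := by
    obtain ⟨v, hv, rfl⟩ := hA
    exact (hx v hv).2
  have hABR : (4 * A : ℝ) ≤ 4 * B := by exact_mod_cast (by omega : 4 * A ≤ 4 * B)
  have htop : ∀ (C σ : ℤ), (4 * C : ℝ) ∈ Set.Icc (4 * A : ℝ) (4 * B) →
      (∀ v ∈ V, x v = C ∨ 1 ≤ σ * (x v - C)) → (∃ v ∈ V, x v = C) →
      ∃ v ∈ V, x v = C ∧ u (4 * C) = 4 * y v := by
    intro C σ hC hσ ⟨v₀, hv₀, hv₀C⟩
    obtain ⟨p, hp, hpmax⟩ := (V.filter fun v => x v = C).exists_max_image y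
      ⟨v₀, Finset.mem_filter.2 ⟨hv₀, hv₀C⟩⟩
    rw [Finset.mem_filter] at hp
    obtain ⟨m, hm, hmmax⟩ := V.exists_max_image y ⟨v₀, hv₀⟩
    refine ⟨p, hp.1, hp.2, le_antisymm ?_ ?_⟩
    · have := hsupp ((y m - y p) * σ) (4 * y p - (y m - y p) * σ * (4 * C)) (by
        intro v hv
        have hmp := hmmax p hp.1
        have hmv := hmmax v hv
        have : y v ≤ (y m - y p) * (σ * (x v - C)) + y p := by
          rcases hσ v hv with h | h
          · have := hpmax v (Finset.mem_filter.2 ⟨hv, h⟩)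
            rw [h]; linarith
          · nlinarith
        have : (y v : ℝ) ≤ (y m - y p) * (σ * (x v - C)) + y p := by exact_mod_cast this
        linarith) _ hC
      linarith
    · have := hle p hp.1
      rwa [hp.2] at this
  obtain ⟨p, hp, hpA, hup⟩ := htop A 1 ⟨le_rfl, hABR⟩
    (fun v hv => by have := hx v hv; omega) hA
  obtain ⟨q, hq, hqB, huq⟩ := htop B (-1) ⟨hABR, le_rfl⟩
    (fun v hv => by have := hx v hv; omega) hB
  have h := even_sum_Ico_floor V x y A B u hcv hx hle hsupp (B - A).toNat p hp q hq (by omega)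
    (by rw [hpA, hup]) (by rw [hqB, huq])
  rw [hpA, hqB] at h
  rw [← Finset.Ico_insert_right (by omega : 4 * A ≤ 4 * B), Finset.sum_insert (by simp)]
  refine Even.add ?_ h
  have : u ((4 * B : ℤ) : ℝ) = ((4 * y q : ℤ) : ℝ) := by push_cast; exact huq
  rw [this, Int.floor_intCast]
  exact ⟨2 * y q, by ring⟩

/-- Let `P` be a convex polygon in `ℝ²` with vertices in `ℤ²` (a two-dimensional convex
polytope).  Then the number of lattice points in `4 • P` is congruent to `1` modulo `2`. -/
theorem lattice_points_in_four_dilate_polygon_odd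
    (V : Finset (Fin 2 → ℤ)) (hV : V.Nonempty)
    (P : Set (Fin 2 → ℝ))
    (hP : P = convexHull ℝ ((fun v : Fin 2 → ℤ => fun i => (v i : ℝ)) '' V))
    (hdim : affineSpan ℝ P = ⊤) :
    {x : Fin 2 → ℤ | (fun i => (x i : ℝ)) ∈ (4 : ℝ) • P}.ncard ≡ 1 [MOD 2] := by
  classical
  obtain ⟨a, ha, hamin⟩ := V.exists_min_image (fun v => v 0) hV
  obtain ⟨b, hb, hbmax⟩ := V.exists_max_image (fun v => v 0) hV
  set A := a 0 with hA
  set B := b 0 with hB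
  set Q : Set (Fin 2 → ℝ) := (4 : ℝ) • P with hQ
  have hQconv : Convex ℝ Q := by
    rw [hQ, hP]; exact (convex_convexHull ℝ _).smul 4
  have hQcpt : IsCompact Q := by
    rw [hQ, hP]
    exact ((V.finite_toSet.image _).isCompact_convexHull (𝕜 := ℝ)).smul 4
  have hVQ : ∀ v ∈ V, ![(4 * v 0 : ℝ), 4 * v 1] ∈ Q := by
    intro v hv
    rw [hQ, hP]
    refine ⟨fun i => (v i : ℝ), subset_convexHull ℝ _ ⟨v, hv, rfl⟩, ?_⟩
    ext i
    fin_cases i <;> simp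
  have hhalf : ∀ c d β : ℝ, (∀ v ∈ V, c * (4 * v 0) + d * (4 * v 1) ≤ β) →
      ∀ z ∈ Q, c * z 0 + d * z 1 ≤ β := by
    intro c d β h z hz
    rw [hQ, hP] at hz
    obtain ⟨w, hw, rfl⟩ := hz
    have hsub : convexHull ℝ ((fun v : Fin 2 → ℤ => fun i => (v i : ℝ)) '' V) ⊆
        {w | (c • LinearMap.proj (R := ℝ) (φ := fun _ : Fin 2 => ℝ) 0 +
          d • LinearMap.proj (R := ℝ) (φ := fun _ : Fin 2 => ℝ) 1) w ≤ β / 4} := by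
      refine convexHull_min ?_ (convex_halfSpace_le (LinearMap.isLinear _) _)
      rintro _ ⟨v, hv, rfl⟩
      have := h v hv
      simp
      linarith
    have := hsub hw
    simp at this ⊢
    linarith
  have hcoord : ∀ z ∈ Q, z 0 ∈ Set.Icc (4 * A : ℝ) (4 * B) := by
    intro z hz
    constructor
    · have := hhalf (-1) 0 (-(4 * A)) (fun v hv => by
        have : (A : ℝ) ≤ v 0 := by exact_mod_cast hamin v hv
        linarith) z hz
      linarith
    · have := hhalf 1 0 (4 * B) (fun v hv => by
        have : (v 0 : ℝ) ≤ B := by exact_mod_cast hbmax v hv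
        linarith) z hz
      linarith
  have hcomb : ∀ s₁ s₂ t₁ t₂ c d : ℝ, ![s₁, t₁] ∈ Q → ![s₂, t₂] ∈ Q → 0 ≤ c → 0 ≤ d →
      c + d = 1 → ![c * s₁ + d * s₂, c * t₁ + d * t₂] ∈ Q := by
    intro s₁ s₂ t₁ t₂ c d h₁ h₂ hc hd hcd
    have := hQconv h₁ h₂ hc hd hcd
    convert this using 1
    ext i
    fin_cases i <;> simp
  have hcol : ∀ t ∈ Set.Icc (4 * A : ℝ) (4 * B), ∃ l u : ℝ,
      ![t, l] ∈ Q ∧ ![t, u] ∈ Q ∧ ∀ s, ![t, s] ∈ Q → l ≤ s ∧ s ≤ u := by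
    intro t ht
    have hcont : Continuous fun s : ℝ => ![t, s] := by fun_prop
    have hne : ∃ s, ![t, s] ∈ Q := by
      rw [← segment_eq_Icc (ht.1.trans ht.2)] at ht
      obtain ⟨c, d, hc, hd, hcd, rfl⟩ := ht
      exact ⟨_, hcomb _ _ _ _ c d (hVQ a ha) (hVQ b hb) hc hd hcd⟩
    have hcpt : IsCompact {s : ℝ | ![t, s] ∈ Q} := by
      have himg : {s : ℝ | ![t, s] ∈ Q} = (fun z : Fin 2 → ℝ => z 1) '' (Q ∩ {z | z 0 = t}) := by
        ext s
        constructor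
        · intro hs
          exact ⟨_, ⟨hs, rfl⟩, rfl⟩
        · rintro ⟨z, ⟨hz, hz0⟩, rfl⟩
          have : ![t, z 1] = z := by
            ext i
            fin_cases i
            · exact hz0.symm
            · rfl
          simpa only [Set.mem_ofPred_eq, this] using hz
      rw [himg]
      exact (hQcpt.inter_right (isClosed_eq (continuous_apply 0) continuous_const)).image
        (continuous_apply 1)
    obtain ⟨l, hl⟩ := hcpt.exists_isLeast hne
    obtain ⟨u, hu⟩ := hcpt.exists_isGreatest hne
    exact ⟨l, u, hl.1, hu.1, fun s hs => ⟨hl.2 hs, hu.2 hs⟩⟩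
  choose! l u hl hu hlu using hcol
  have hu_even : Even (∑ i ∈ Finset.Icc (4 * A) (4 * B), ⌊u i⌋) := by
    refine even_sum_Icc_floor V (fun v => v 0) (fun v => v 1) A B u ?_
      (fun v hv => ⟨hamin v hv, hbmax v hv⟩) ⟨a, ha, rfl⟩ ⟨b, hb, rfl⟩ ?_ ?_
    · refine ⟨convex_Icc _ _, fun s hs t ht c d hc hd hcd => ?_⟩
      have h := hcomb _ _ _ _ c d (hu s hs) (hu t ht) hc hd hcd
      exact (hlu _ (hcoord _ h) _ h).2
    · intro v hv
      exact (hlu _ (hcoord _ (hVQ v hv)) _ (hVQ v hv)).2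
    · intro α β h t ht
      have := hhalf (-α) 1 β (fun v hv => by linarith [h v hv]) _ (hu t ht)
      simp at this
      linarith
  have hl_even : Even (∑ i ∈ Finset.Icc (4 * A) (4 * B), ⌊-l i⌋) := by
    refine even_sum_Icc_floor V (fun v => v 0) (fun v => -v 1) A B (fun t => -l t) ?_
      (fun v hv => ⟨hamin v hv, hbmax v hv⟩) ⟨a, ha, rfl⟩ ⟨b, hb, rfl⟩ ?_ ?_
    · refine ⟨convex_Icc _ _, fun s hs t ht c d hc hd hcd => ?_⟩
      have h := hcomb _ _ _ _ c d (hl s hs) (hl t ht) hc hd hcd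
      have := (hlu _ (hcoord _ h) _ h).1
      simp only [smul_eq_mul, Matrix.cons_val_zero] at this ⊢
      linarith
    · intro v hv
      have := (hlu _ (hcoord _ (hVQ v hv)) _ (hVQ v hv)).1
      simp only [Matrix.cons_val_zero] at this
      push_cast
      linarith
    · intro α β h t ht
      have := hhalf (-α) (-1) β (fun v hv => by
        have := h v hv
        push_cast at this
        linarith) _ (hl t ht)
      simp at this
      linarith
  have hmemQ : ∀ i j : ℤ, ![(i : ℝ), (j : ℝ)] ∈ Q ↔
      i ∈ Finset.Icc (4 * A) (4 * B) ∧ j ∈ Finset.Icc ⌈l i⌉ ⌊u i⌋ := by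
    intro i j
    have hiff : (i : ℝ) ∈ Set.Icc (4 * A : ℝ) (4 * B) ↔ i ∈ Finset.Icc (4 * A) (4 * B) := by
      rw [Finset.mem_Icc, Set.mem_Icc]; norm_cast
    rw [← hiff, Finset.mem_Icc, Int.ceil_le, Int.le_floor]
    constructor
    · intro h
      exact ⟨hcoord _ h, hlu _ (hcoord _ h) _ h⟩
    · rintro ⟨hi, hj⟩
      have hj' : (j : ℝ) ∈ Set.Icc (l i) (u i) := hj
      rw [← segment_eq_Icc (hj.1.trans hj.2)] at hj'
      obtain ⟨c, d, hc, hd, hcd, hj'⟩ := hj'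
      have := hcomb _ _ _ _ c d (hl _ hi) (hu _ hi) hc hd hcd
      simp only [smul_eq_mul] at hj'
      rwa [hj', ← add_mul, hcd, one_mul] at this
  have hcard : {x : Fin 2 → ℤ | (fun i => (x i : ℝ)) ∈ Q}.ncard =
      ((Finset.Icc (4 * A) (4 * B)).sigma fun i => Finset.Icc ⌈l i⌉ ⌊u i⌋).card := by
    rw [← Set.ncard_coe_finset]
    refine Set.ncard_congr (fun x _ => ⟨x 0, x 1⟩) ?_ ?_ ?_
    · intro x hx
      have : (fun i => (x i : ℝ)) = ![(x 0 : ℝ), (x 1 : ℝ)] := by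
        ext i; fin_cases i <;> rfl
      rw [Set.mem_ofPred_eq, this, hmemQ] at hx
      simpa only [Finset.mem_coe, Finset.mem_sigma] using hx
    · intro x z _ _ h
      simp only [Sigma.mk.injEq, heq_eq_eq] at h
      ext i
      fin_cases i
      · exact h.1
      · exact h.2
    · rintro ⟨i, j⟩ h
      rw [Finset.mem_coe, Finset.mem_sigma, ← hmemQ] at h
      refine ⟨![i, j], ?_, rfl⟩
      have : (fun k => ((![i, j] : Fin 2 → ℤ) k : ℝ)) = ![(i : ℝ), (j : ℝ)] := by
        ext k; fin_cases k <;> rfl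
      rwa [Set.mem_ofPred_eq, this]
  have hAB : A ≤ B := hamin b hb
  have hsum : (({x : Fin 2 → ℤ | (fun i => (x i : ℝ)) ∈ Q}.ncard : ℕ) : ℤ) =
      ∑ i ∈ Finset.Icc (4 * A) (4 * B), ⌊u i⌋ + ∑ i ∈ Finset.Icc (4 * A) (4 * B), ⌊-l i⌋ +
        (4 * (B - A) + 1) := by
    have hone : (4 * (B - A) + 1 : ℤ) = ∑ i ∈ Finset.Icc (4 * A) (4 * B), 1 := by
      rw [Finset.sum_const, Int.card_Icc, nsmul_eq_mul, mul_one]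
      omega
    rw [hcard, Finset.card_sigma, hone, ← Finset.sum_add_distrib, ← Finset.sum_add_distrib]
    push_cast
    refine Finset.sum_congr rfl fun i hi => ?_
    have hi' : (i : ℝ) ∈ Set.Icc (4 * A : ℝ) (4 * B) := by
      rw [Finset.mem_Icc] at hi
      exact ⟨by exact_mod_cast hi.1, by exact_mod_cast hi.2⟩
    have hlei := (hlu _ hi' _ (hl _ hi')).2
    have hceil : ⌈l i⌉ ≤ ⌊u i⌋ + 1 := (Int.ceil_le_floor_add_one _).trans
      (by have := Int.floor_le_floor hlei; omega)
    rw [Int.card_Icc, Int.floor_neg]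
    omega
  obtain ⟨k, hk⟩ := hu_even
  obtain ⟨m, hm⟩ := hl_even
  rw [hk, hm] at hsum
  unfold Nat.ModEq
  omega
end

section
/- Let P be a d-dimensional convex polytope in ℝ^d with all vertices in the integer lattice ℤ^d. Then there exist nonnegative integers h₁, h₂, …, h_d such that for every positive integer t, the number of lattice points of ℤ^d contained in the dilated polytope t·P equals C(t + d, d) + h₁·C(t + d − 1, d) + ⋯ + h_{d−1}·C(t + 1, d) + h_d·C(t, d). -/
open scoped Pointwise

namespace Ehrhart

open Finset Filter Topology Module

section Genericity

theorem exists_pos_forall_ne_zero {ι J : Type*} [Fintype ι] [Finite J]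
    (ℓ : J → (ι → ℝ) →ₗ[ℝ] ℝ) (hℓ : ∀ j, ℓ j ≠ 0) :
    ∃ a : ι → ℝ, (∀ i, 0 < a i) ∧ ∀ j, ℓ j a ≠ 0 := by
  classical
  have : Fintype J := Fintype.ofFinite J
  let e := Fintype.equivFin ι
  let p : J → Polynomial ℝ := fun j => ∑ i, Polynomial.monomial (e i) (ℓ j (Pi.single i 1))
  have hp : ∀ j, p j ≠ 0 := by
    intro j h
    refine hℓ j (LinearMap.pi_ext' fun i => LinearMap.ext_ring ?_)
    have h' := congrArg (fun q => q.coeff (e i)) h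
    simpa [p, Polynomial.finsetSum_coeff, Polynomial.coeff_monomial, Fin.val_inj] using h'
  have hfin : ((∏ j, p j).roots.toFinset : Set ℝ).Finite := Finset.finite_toSet _
  obtain ⟨s, hs, hs'⟩ := ((Set.Ioi_infinite (0 : ℝ)).sdiff hfin).nonempty
  refine ⟨fun i => s ^ (e i : ℕ), fun i => pow_pos hs _, fun j hj => hs' ?_⟩
  have hev : (p j).eval s = 0 := by
    rw [← hj, LinearMap.pi_apply_eq_sum_univ (ℓ j)]
    simp [p, Polynomial.eval_finsetSum, mul_comm, ← Pi.single_apply, Pi.single_comm]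
  have hne : ∏ j, p j ≠ 0 := prod_ne_zero_iff.2 fun j _ => hp j
  simp only [mem_coe, Multiset.mem_toFinset]
  rw [Polynomial.mem_roots hne, Polynomial.IsRoot, Polynomial.eval_prod]
  exact prod_eq_zero (mem_univ j) hev

theorem eventually_sign_add_mul (a : ℝ) {b : ℝ} (hb : b ≠ 0) :
    ∀ᶠ ε in 𝓝[>] (0 : ℝ), a + ε * b ≠ 0 ∧ (0 < a + ε * b ↔ 0 ≤ a ∧ (b < 0 → 0 < a)) := by
  have hc : Tendsto (fun ε : ℝ => a + ε * b) (𝓝[>] 0) (𝓝 a) := by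
    have : Continuous fun ε : ℝ => a + ε * b := by fun_prop
    simpa using (this.tendsto 0).mono_left nhdsWithin_le_nhds
  rcases lt_trichotomy a 0 with ha | rfl | ha
  · filter_upwards [hc.eventually_lt_const ha] with ε hε
    exact ⟨hε.ne, iff_of_false hε.not_gt fun h => ha.not_ge h.1⟩
  · filter_upwards [self_mem_nhdsWithin] with ε hε
    have hε : 0 < ε := hε
    simp [hε.ne', hb, mul_pos_iff_of_pos_left hε, lt_iff_le_and_ne, hb.symm]
  · filter_upwards [hc.eventually_const_lt ha] with ε hε
    exact ⟨hε.ne', by simp [hε, ha, ha.le]⟩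

end Genericity

section Cells

theorem sum_dite_add_ite_smul {ι F : Type*} [Fintype ι] [DecidableEq ι] [AddCommGroup F]
    [Module ℝ F] (s : Finset ι) (g : s → ℝ) (w : ι) (ε : ℝ) (f : ι → F) :
    ∑ i, ((if h : i ∈ s then g ⟨i, h⟩ else 0) + if i = w then ε else 0) • f i =
      ∑ u : s, g u • f u + ε • f w := by
  simp only [add_smul, sum_add_distrib]
  congr 1
  · rw [← sum_subset (subset_univ s) (fun i _ hi => by simp [hi]), ← sum_coe_sort]
    simp
  · simp

variable {ι E : Type*} [AddCommGroup E] [Module ℝ E]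

/-- The sets of indices whose vectors form a basis. -/
abbrev Cell (v : ι → E) : Type _ :=
  {σ : Finset ι // LinearIndepOn ℝ v (σ : Set ι) ∧ Submodule.span ℝ (v '' σ) = ⊤}

namespace Cell

variable {v : ι → E}

/-- The basis of a cell. -/
noncomputable def basis (σ : Cell v) : Basis σ.1 ℝ E :=
  Basis.mk (v := fun u : σ.1 => v u) σ.2.1 (by
    have h := σ.2.2.ge
    rwa [Set.image_eq_range] at h)

@[simp] theorem basis_apply (σ : Cell v) (u : σ.1) : σ.basis u = v u :=
  Basis.mk_apply ..

theorem exists_supset [Finite ι] (hv : Submodule.span ℝ (Set.range v) = ⊤) {s : Set ι}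
    (hs : LinearIndepOn ℝ v s) : ∃ σ : Cell v, s ⊆ σ.1 := by
  classical
  have := Fintype.ofFinite ι
  refine ⟨⟨(hs.extend (Set.subset_univ s)).toFinset, ?_, ?_⟩, ?_⟩
  · simpa using hs.linearIndepOn_extend (Set.subset_univ s)
  · simpa [hv] using hs.span_image_extend_eq_span_image (Set.subset_univ s)
  · simpa using hs.subset_extend (Set.subset_univ s)

/-- The linear functional taking prescribed values on the basis of a cell. -/
noncomputable def extension (σ : Cell v) (ω : ι → ℝ) : E →ₗ[ℝ] ℝ :=
  σ.basis.constr ℝ fun u => ω u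

@[simp] theorem extension_apply_mem (σ : Cell v) (ω : ι → ℝ) {u : ι} (hu : u ∈ σ.1) :
    σ.extension ω (v u) = ω u := by
  have := σ.basis.constr_basis ℝ (fun u : σ.1 => ω u) ⟨u, hu⟩
  rwa [basis_apply] at this

theorem extension_eq_sum (σ : Cell v) (ω : ι → ℝ) (y : E) :
    σ.extension ω y = ∑ u : σ.1, σ.basis.repr y u * ω u := by
  simp [extension, Basis.constr_apply_fintype]

theorem sum_repr (σ : Cell v) (y : E) : ∑ u : σ.1, σ.basis.repr y u • v u = y := by
  simpa using σ.basis.sum_repr y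

theorem exists_generic_weight [Finite ι] (v : ι → E) :
    ∃ ω : ι → ℝ, ∀ (σ : Cell v) (w : ι), w ∉ σ.1 → σ.extension ω (v w) ≠ ω w := by
  classical
  have := Fintype.ofFinite ι
  let J := {p : Cell v × ι // p.2 ∉ p.1.1}
  let ℓ : J → (ι → ℝ) →ₗ[ℝ] ℝ := fun j =>
    (∑ u : j.1.1.1, j.1.1.basis.repr (v j.1.2) u • LinearMap.proj (u : ι)) - LinearMap.proj j.1.2
  have hℓ : ∀ j, ℓ j ≠ 0 := by
    rintro ⟨⟨σ, w⟩, hw⟩ h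
    have h' := LinearMap.congr_fun h (Pi.single w 1)
    have hz : ∀ u : σ.1, (Pi.single w (1 : ℝ) : ι → ℝ) u = 0 := fun u =>
      Pi.single_eq_of_ne (fun h : (u : ι) = w => hw (h ▸ u.2)) _
    simp [ℓ, hz] at h'
  obtain ⟨ω, -, hω⟩ := exists_pos_forall_ne_zero ℓ hℓ
  refine ⟨ω, fun σ w hw h => hω ⟨⟨σ, w⟩, hw⟩ ?_⟩
  rw [extension_eq_sum] at h
  simpa [ℓ, sub_eq_zero, -univ_eq_attach] using h

theorem exists_generic_point [Fintype ι] (v : ι → E) :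
    ∃ a : ι → ℝ, (∀ i, 0 < a i) ∧
      ∀ (σ : Cell v) (u : σ.1), σ.basis.repr (∑ i, a i • v i) u ≠ 0 := by
  classical
  let ℓ : (Σ σ : Cell v, σ.1) → (ι → ℝ) →ₗ[ℝ] ℝ := fun j =>
    j.1.basis.coord j.2 ∘ₗ Fintype.linearCombination ℝ v
  have hℓ : ∀ j, ℓ j ≠ 0 := by
    rintro ⟨σ, u⟩ h
    have h' := LinearMap.congr_fun h (Pi.single (u : ι) 1)
    have : σ.basis.repr (v u) u = 1 := by
      rw [← σ.basis_apply, Basis.repr_self]; simp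
    simp [ℓ, this] at h'
  obtain ⟨a, ha, ha'⟩ := exists_pos_forall_ne_zero ℓ hℓ
  exact ⟨a, ha, fun σ u => by simpa [ℓ, Fintype.linearCombination_apply] using ha' ⟨σ, u⟩⟩

end Cell

variable [Fintype ι] {v : ι → E} {ht : E →ₗ[ℝ] ℝ}

/-- Conical Carathéodory theorem which does not increase a linear cost. -/
theorem exists_linearIndepOn_cost_le (hht : ∀ i, ht (v i) = 1) (ω : ι → ℝ)
    (c : ι → ℝ) (hc : ∀ i, 0 ≤ c i) :
    ∃ c' : ι → ℝ, (∀ i, 0 ≤ c' i) ∧ ∑ i, c' i • v i = ∑ i, c i • v i ∧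
      ∑ i, c' i * ω i ≤ ∑ i, c i * ω i ∧ LinearIndepOn ℝ v {i | c' i ≠ 0} := by
  classical
  induction hn : #{i | c i ≠ 0} using Nat.strong_induction_on generalizing c with
  | _ n ih =>
  by_cases hli : LinearIndepOn ℝ v {i | c i ≠ 0}
  · exact ⟨c, hc, rfl, le_rfl, hli⟩
  obtain ⟨g, hg0, hgsupp, hgcost, u, hu⟩ : ∃ g : ι → ℝ, ∑ i, g i • v i = 0 ∧
      (∀ i, c i = 0 → g i = 0) ∧ 0 ≤ ∑ i, g i * ω i ∧ ∃ u, 0 < g u := by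
    have hli' : ¬ LinearIndepOn ℝ v (({i | c i ≠ 0} : Finset ι) : Set ι) := by simpa using hli
    obtain ⟨f, hf0, j, hj, hfj⟩ := not_linearIndepOn_finset_iff.1 hli'
    let g : ι → ℝ := fun i => if c i ≠ 0 then f i else 0
    have hg0 : ∑ i, g i • v i = 0 := by
      rw [← hf0, sum_filter]
      exact sum_congr rfl fun i _ => by simp only [g]; split_ifs <;> simp
    have hgs : ∑ i, g i = 0 := by simpa [hht] using congrArg ht hg0
    have hgj : g j ≠ 0 := by
      have : c j ≠ 0 := by simpa using hj
      simpa [g, this] using hfj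
    have hpos : ∃ u, 0 < g u := by
      by_contra! h
      exact hgj ((sum_eq_zero_iff_of_nonpos fun i _ => h i).1 hgs j (mem_univ j))
    have hneg : ∃ u, g u < 0 := by
      by_contra! h
      exact hgj ((sum_eq_zero_iff_of_nonneg fun i _ => h i).1 hgs j (mem_univ j))
    rcases le_total 0 (∑ i, g i * ω i) with h | h
    · exact ⟨g, hg0, fun i hi => by simp [g, hi], h, hpos⟩
    · refine ⟨fun i => - g i, by simp [hg0], fun i hi => by simp [g, hi], by simpa using h, ?_⟩
      simpa using hneg
  obtain ⟨m, hm, hmin⟩ := exists_min_image ({i | 0 < g i} : Finset ι) (fun i => c i / g i)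
    ⟨u, by simpa using hu⟩
  have hgm : 0 < g m := by simpa using hm
  set s := c m / g m with hs
  have hs0 : 0 ≤ s := div_nonneg (hc m) hgm.le
  have hcm : c m ≠ 0 := fun h => hgm.ne' (hgsupp m h)
  obtain ⟨c', h1, h2, h3, h4⟩ := ih #{i | c i - s * g i ≠ 0} (by
      rw [← hn]
      refine card_lt_card ⟨fun i => ?_, fun h => ?_⟩
      · simp only [mem_filter, mem_univ, true_and]
        intro h h'
        exact h (by simp [h', hgsupp i h'])
      · have := h (show m ∈ _ by simpa using hcm)
        simp [hs, hgm.ne'] at this)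
    (fun i => c i - s * g i) (fun i => by
      rcases le_or_gt (g i) 0 with h | h
      · nlinarith [hc i]
      · have := hmin i (by simpa using h)
        rw [le_div_iff₀ h] at this
        simpa using this) rfl
  refine ⟨c', h1, ?_, ?_, h4⟩
  · rw [h2]
    simp [sub_smul, mul_smul, ← smul_sum, hg0]
  · refine h3.trans ?_
    simp only [sub_mul, sum_sub_distrib, mul_assoc, ← mul_sum]
    nlinarith

theorem exists_cell_cost_le (hv : Submodule.span ℝ (Set.range v) = ⊤)
    (hht : ∀ i, ht (v i) = 1) (ω c : ι → ℝ) (hc : ∀ i, 0 ≤ c i) :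
    ∃ σ : Cell v, (∀ u, 0 ≤ σ.basis.repr (∑ i, c i • v i) u) ∧
      σ.extension ω (∑ i, c i • v i) ≤ ∑ i, c i * ω i := by
  obtain ⟨c', h1, h2, h3, h4⟩ := exists_linearIndepOn_cost_le hht ω c hc
  obtain ⟨σ, hσ⟩ := Cell.exists_supset hv h4
  have hz : ∀ i ∉ σ.1, c' i = 0 := fun i hi => by
    by_contra h
    exact hi (hσ h)
  have hsum : ∑ i, c i • v i = ∑ u : σ.1, c' u • σ.basis u := by
    rw [← h2, ← sum_subset (subset_univ σ.1) (fun i _ hi => by simp [hz i hi]), ← sum_coe_sort]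
    simp
  refine ⟨σ, fun u => ?_, ?_⟩
  · rw [hsum, Basis.repr_sum_self]
    exact h1 u
  · refine le_trans (le_of_eq ?_) h3
    rw [hsum, Cell.extension_eq_sum, Basis.repr_sum_self,
      ← sum_subset (subset_univ σ.1) (fun i _ hi => by simp [hz i hi]), ← sum_coe_sort σ.1]

/-- The cells of the regular subdivision induced by the heights `ω`. -/
def IsLower (ω : ι → ℝ) (σ : Cell v) : Prop := ∀ i, σ.extension ω (v i) ≤ ω i

theorem existsUnique_isLower (hv : Submodule.span ℝ (Set.range v) = ⊤)
    (hht : ∀ i, ht (v i) = 1) {ω : ι → ℝ}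
    (hω : ∀ (σ : Cell v) (w : ι), w ∉ σ.1 → σ.extension ω (v w) ≠ ω w)
    {c : ι → ℝ} (hc : ∀ i, 0 ≤ c i) {y : E} (hy : y = ∑ i, c i • v i)
    (hgen : ∀ (σ : Cell v) (u : σ.1), σ.basis.repr y u ≠ 0) :
    ∃! σ : Cell v, IsLower ω σ ∧ ∀ u, 0 < σ.basis.repr y u := by
  classical
  have hle : ∀ σ τ : Cell v, IsLower ω σ → (∀ u, 0 < τ.basis.repr y u) →
      σ.extension ω y ≤ τ.extension ω y ∧ (τ.extension ω y ≤ σ.extension ω y → τ.1 ⊆ σ.1) := by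
    intro σ τ hσ hτ
    have h1 : σ.extension ω y = ∑ u : τ.1, τ.basis.repr y u * σ.extension ω (v u) := by
      conv_lhs => rw [← τ.sum_repr y]
      simp
    rw [h1, τ.extension_eq_sum]
    have hterm : ∀ u : τ.1, τ.basis.repr y u * σ.extension ω (v u) ≤ τ.basis.repr y u * ω u :=
      fun u => mul_le_mul_of_nonneg_left (hσ u) (hτ u).le
    refine ⟨sum_le_sum fun u _ => hterm u, fun h i hi => ?_⟩
    by_contra hiσ
    refine absurd h (not_le.2 (sum_lt_sum (fun u _ => hterm u) ⟨⟨i, hi⟩, mem_univ _, ?_⟩))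
    exact mul_lt_mul_of_pos_left (lt_of_le_of_ne (hσ i) (hω σ i hiσ)) (hτ _)
  have hex : ∃ σ : Cell v, IsLower ω σ ∧ ∀ u, 0 < σ.basis.repr y u := by
    obtain ⟨σ₀, hσ₀, -⟩ := exists_cell_cost_le hv hht ω c hc
    obtain ⟨σ, hσ, hmin⟩ := Set.exists_min_image {σ : Cell v | ∀ u, 0 ≤ σ.basis.repr y u}
      (fun σ => σ.extension ω y) (Set.toFinite _) ⟨σ₀, by simpa [hy] using hσ₀⟩
    have hpos : ∀ u, 0 < σ.basis.repr y u := fun u => lt_of_le_of_ne (hσ u) (hgen σ u).symm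
    refine ⟨σ, fun w => ?_, hpos⟩
    by_contra! hw
    have hev : ∀ᶠ ε in 𝓝[>] (0 : ℝ), ∀ u : σ.1,
        0 < σ.basis.repr y u + ε * -σ.basis.repr (v w) u := by
      refine eventually_all.2 fun u => ?_
      have : Continuous fun ε : ℝ => σ.basis.repr y u + ε * -σ.basis.repr (v w) u := by fun_prop
      exact ((this.tendsto 0).mono_left nhdsWithin_le_nhds).eventually_const_lt
        (by simpa using hpos u)
    obtain ⟨ε, hε, hε0⟩ := (hev.and self_mem_nhdsWithin).exists
    have hε0 : 0 < ε := hε0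
    let g : σ.1 → ℝ := fun u => σ.basis.repr y u + ε * -σ.basis.repr (v w) u
    let c' : ι → ℝ := fun i => (if h : i ∈ σ.1 then g ⟨i, h⟩ else 0) + if i = w then ε else 0
    have hc' : ∀ i, 0 ≤ c' i := fun i => by
      refine add_nonneg ?_ (by split_ifs <;> simp [hε0.le])
      split_ifs with h
      · exact (hε _).le
      · exact le_rfl
    have hy' : ∑ i, c' i • v i = y := by
      refine (sum_dite_add_ite_smul σ.1 g w ε v).trans ?_
      simp only [g, add_smul, sum_add_distrib, mul_smul, neg_smul, ← smul_sum, sum_neg_distrib,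
        σ.sum_repr]
      simp
    obtain ⟨τ, hτ, hcost⟩ := exists_cell_cost_le hv hht ω c' hc'
    rw [hy'] at hτ hcost
    have h1 := hmin τ hτ
    have h2 : ∑ i, c' i * ω i = _ := sum_dite_add_ite_smul σ.1 g w ε ω
    simp only [g, smul_eq_mul, add_mul, sum_add_distrib, mul_assoc, neg_mul, ← mul_sum,
      sum_neg_distrib, ← σ.extension_eq_sum] at h2
    nlinarith
  obtain ⟨σ, hσ, hσy⟩ := hex
  refine ⟨σ, ⟨hσ, hσy⟩, fun τ ⟨hτ, hτy⟩ => Subtype.ext ?_⟩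
  have h1 := hle σ τ hσ hτy
  have h2 := hle τ σ hτ hσy
  exact subset_antisymm (h1.2 h2.1) (h2.2 h1.1)

/-- A cone over finitely many vectors at height one is partitioned into half-open simplicial
cones, none of which is fully open. -/
theorem exists_halfOpen_partition [Nonempty ι] (hv : Submodule.span ℝ (Set.range v) = ⊤)
    (hht : ∀ i, ht (v i) = 1) :
    ∃ (T : Set (Cell v)) (A : ∀ σ : Cell v, Set σ.1), (∀ σ, A σ ≠ Set.univ) ∧
      ∀ c : ι → ℝ, (∀ i, 0 ≤ c i) → ∃! σ : Cell v, σ ∈ T ∧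
        ∀ u, 0 ≤ σ.basis.repr (∑ i, c i • v i) u ∧
          (u ∈ A σ → 0 < σ.basis.repr (∑ i, c i • v i) u) := by
  classical
  obtain ⟨ω, hω⟩ := Cell.exists_generic_weight v
  obtain ⟨a, ha, hgen⟩ := Cell.exists_generic_point v
  refine ⟨{σ | IsLower ω σ}, fun σ => {u | σ.basis.repr (∑ i, a i • v i) u < 0}, ?_, ?_⟩
  · intro σ hA
    have h := congrArg ht (σ.sum_repr (∑ i, a i • v i))
    set q := ∑ i, a i • v i with hq
    have hq' : ht q = ∑ i, a i := by simp [hq, hht]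
    simp only [map_sum ht, map_smul, hht, smul_eq_mul, mul_one, hq'] at h
    have h1 : 0 < ∑ i, a i := sum_pos (fun i _ => ha i) univ_nonempty
    have h2 : ∑ u, σ.basis.repr q u ≤ 0 :=
      sum_nonpos fun u _ => le_of_lt (by simpa using hA.ge (Set.mem_univ u))
    linarith
  · intro c hc
    set x := ∑ i, c i • v i
    set q := ∑ i, a i • v i
    have hev : ∀ᶠ ε in 𝓝[>] (0 : ℝ), ∀ (σ : Cell v) (u : σ.1),
        σ.basis.repr x u + ε * σ.basis.repr q u ≠ 0 ∧
        (0 < σ.basis.repr x u + ε * σ.basis.repr q u ↔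
          0 ≤ σ.basis.repr x u ∧ (σ.basis.repr q u < 0 → 0 < σ.basis.repr x u)) :=
      eventually_all.2 fun σ => eventually_all.2 fun u => eventually_sign_add_mul _ (hgen σ u)
    obtain ⟨ε, hε, hε0⟩ := (hev.and self_mem_nhdsWithin).exists
    have hε0 : 0 < ε := hε0
    have hrepr : ∀ (σ : Cell v) (u : σ.1), σ.basis.repr (x + ε • q) u =
        σ.basis.repr x u + ε * σ.basis.repr q u := fun σ u => by simp
    have := existsUnique_isLower hv hht hω (c := fun i => c i + ε * a i) (y := x + ε • q)
      (fun i => add_nonneg (hc i) (mul_pos hε0 (ha i)).le)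
      (by simp [x, q, add_smul, sum_add_distrib, smul_sum, mul_smul])
      (fun σ u => by rw [hrepr]; exact (hε σ u).1)
    simpa only [hrepr, fun σ u => (hε σ u).2, Set.mem_ofPred_eq] using this

end Cells
section Counting

theorem card_piAntidiag_univ (κ : Type*) [Fintype κ] [DecidableEq κ] (n : ℕ) :
    #(piAntidiag (univ : Finset κ) n) = (Fintype.card κ + n - 1).choose n := by
  rw [← map_sym_eq_piAntidiag, card_map, sym_univ, card_univ, Sym.card_sym_eq_choose]

theorem exists_nat_sub_mem_unit (a : Prop) {x : ℝ} (hx : 0 ≤ x ∧ (a → 0 < x)) :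
    ∃ n : ℕ, (0 ≤ x - n ∧ (a → 0 < x - n)) ∧ x - n ≤ 1 ∧ (¬ a → x - n < 1) := by
  by_cases ha : a
  · have hpos : 0 < ⌈x⌉₊ := Nat.ceil_pos.2 (hx.2 ha)
    have h1 := Nat.le_ceil x
    have h2 := Nat.ceil_lt_add_one hx.1
    refine ⟨⌈x⌉₊ - 1, ?_⟩
    rw [Nat.cast_sub hpos]
    push_cast
    exact ⟨⟨by linarith, fun _ => by linarith⟩, by linarith, fun h => absurd ha h⟩
  · have h1 := Nat.floor_le hx.1
    have h2 := Nat.lt_floor_add_one x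
    exact ⟨⌊x⌋₊, ⟨by linarith, fun h => absurd h ha⟩, by linarith, fun _ => by linarith⟩

theorem eq_of_add_eq_add_of_mem_unit (a : Prop) {x y : ℝ} {m n : ℕ}
    (hx : 0 ≤ x ∧ (a → 0 < x)) (hx' : x ≤ 1 ∧ (¬ a → x < 1))
    (hy : 0 ≤ y ∧ (a → 0 < y)) (hy' : y ≤ 1 ∧ (¬ a → y < 1)) (h : x + m = y + n) : m = n := by
  have h1 : x - y < 1 ∧ y - x < 1 := by
    by_cases ha : a
    · have := hx.2 ha
      have := hy.2 ha
      constructor <;> linarith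
    · have := hx'.2 ha
      have := hy'.2 ha
      constructor <;> linarith
  have h2 : (m : ℝ) < n + 1 := by linarith
  have h3 : (n : ℝ) < m + 1 := by linarith
  norm_cast at h2 h3
  omega

variable {κ E Λ : Type*} [Fintype κ] [AddCommGroup E] [Module ℝ E] [AddCommGroup Λ]

/-- The points of the lattice `Λ` in a half-open simplicial cone, at a given height. -/
def halfOpenCone (b : Basis κ ℝ E) (emb : Λ →+ E) (ht : Λ →+ ℤ) (A : Set κ) (t : ℤ) : Set Λ :=
  {p | ht p = t ∧ ∀ i, 0 ≤ b.repr (emb p) i ∧ (i ∈ A → 0 < b.repr (emb p) i)}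

theorem ncard_halfOpenCone (b : Basis κ ℝ E) (emb : Λ →+ E)
    (ht : Λ →+ ℤ) (w : κ → Λ) (hb : ∀ i, emb (w i) = b i)
    (hht : ∀ p, (ht p : ℝ) = ∑ i, b.repr (emb p) i) {A : Set κ} (hA : A ≠ Set.univ)
    (hfin : ∀ t, (halfOpenCone b emb ht A t).Finite) :
    ∃ h : ℕ → ℕ, ∀ t : ℕ, (halfOpenCone b emb ht A t).ncard =
      ∑ k ∈ range (Fintype.card κ),
        h k * (t + (Fintype.card κ - 1) - k).choose (Fintype.card κ - 1) := by
  classical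
  set m := Fintype.card κ with hm
  obtain ⟨j, hj⟩ := (Set.ne_univ_iff_exists_notMem A).1 hA
  have hmpos : 0 < m := Fintype.card_pos_iff.2 ⟨j⟩
  have htw : ∀ i, ht (w i) = 1 := fun i => by
    have h := hht (w i)
    rw [hb] at h
    have h' : ∑ k, b.repr (b i) k = 1 := by simp [Finsupp.single_apply]
    rw [h'] at h
    exact_mod_cast h
  have hreprw : ∀ (n : κ → ℕ) i, b.repr (emb (∑ k, n k • w k)) i = n i := fun n i => by
    have h : emb (∑ k, n k • w k) = ∑ k, (n k : ℝ) • b k := by simp [hb, Nat.cast_smul_eq_nsmul]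
    rw [h, Basis.repr_sum_self]
  let box : ℕ → Finset Λ := fun k => {p ∈ (hfin k).toFinset |
    ∀ i, b.repr (emb p) i ≤ 1 ∧ (i ∉ A → b.repr (emb p) i < 1)}
  have mem_box : ∀ k p, p ∈ box k ↔ (ht p = k ∧
      ∀ i, 0 ≤ b.repr (emb p) i ∧ (i ∈ A → 0 < b.repr (emb p) i)) ∧
      ∀ i, b.repr (emb p) i ≤ 1 ∧ (i ∉ A → b.repr (emb p) i < 1) := fun k p => by
    simp [box, halfOpenCone]
  let tails : ℕ → ℕ → Finset (κ → ℕ) := fun t k =>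
    if k ≤ t then piAntidiag univ (t - k) else ∅
  have mem_tails : ∀ t k n, n ∈ tails t k ↔ k + ∑ i, n i = t := fun t k n => by
    simp only [tails]
    split_ifs with h
    · refine Iff.trans ?_ (show ∑ i, n i = t - k ↔ _ by omega)
      simp
    · simp only [notMem_empty, false_iff]
      omega
  have card_tails : ∀ t k, k < m → #(tails t k) = (t + (m - 1) - k).choose (m - 1) := by
    intro t k hk
    simp only [tails]
    split_ifs with h
    · rw [card_piAntidiag_univ, ← hm, ← Nat.choose_symm_of_eq_add (show
        m + (t - k) - 1 = (m - 1) + (t - k) by omega)]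
      congr 1
      omega
    · rw [card_empty, Nat.choose_eq_zero_of_lt (by omega)]
  refine ⟨fun k => #(box k), fun t => ?_⟩
  rw [Set.ncard_eq_toFinset_card _ (hfin t)]
  have hcard : #((range m).sigma fun k => box k ×ˢ tails t k) =
      ∑ k ∈ range m, #(box k) * (t + (m - 1) - k).choose (m - 1) := by
    rw [card_sigma]
    exact sum_congr rfl fun k hk => by rw [card_product, card_tails t k (mem_range.1 hk)]
  rw [← hcard]
  symm
  refine card_nbij (fun x => x.2.1 + ∑ i, x.2.2 i • w i) ?_ ?_ ?_
  · rintro ⟨k, p, n⟩ hx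
    simp only [coe_sigma, Set.mem_sigma_iff, coe_product, Set.mem_prod, mem_coe, mem_box,
      mem_tails] at hx
    obtain ⟨-, ⟨⟨hk, hp⟩, -⟩, hn⟩ := hx
    simp only [Set.Finite.coe_toFinset, halfOpenCone, Set.mem_ofPred_eq, map_add, Finsupp.add_apply,
      hreprw]
    refine ⟨?_, fun i => ⟨add_nonneg (hp i).1 (Nat.cast_nonneg _),
      fun hi => add_pos_of_pos_of_nonneg ((hp i).2 hi) (Nat.cast_nonneg _)⟩⟩
    simp only [hk, map_sum, map_nsmul, htw, ← hn]
    simp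
  · rintro ⟨k, p, n⟩ hx ⟨k', p', n'⟩ hx' heq
    simp only [coe_sigma, Set.mem_sigma_iff, coe_product, Set.mem_prod, mem_coe, mem_box,
      mem_tails] at hx hx'
    obtain ⟨-, ⟨⟨hk, hp⟩, hp1⟩, -⟩ := hx
    obtain ⟨-, ⟨⟨hk', hp'⟩, hp1'⟩, -⟩ := hx'
    have hn : n = n' := by
      funext i
      have h := congrArg (fun q => b.repr (emb q) i) heq
      simp only [map_add, Finsupp.add_apply, hreprw] at h
      exact eq_of_add_eq_add_of_mem_unit (i ∈ A) (hp i) (hp1 i) (hp' i) (hp1' i) h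
    subst hn
    obtain rfl : p = p' := add_right_cancel heq
    obtain rfl : k = k' := by exact_mod_cast hk.symm.trans hk'
    rfl
  · intro p hp
    simp only [Set.Finite.coe_toFinset, halfOpenCone, Set.mem_ofPred_eq] at hp
    choose n hn using fun i => exists_nat_sub_mem_unit (i ∈ A) (hp.2 i)
    let q := p - ∑ i, n i • w i
    have hq : ∀ i, b.repr (emb q) i = b.repr (emb p) i - n i := fun i => by
      simp only [q, map_sub, Finsupp.sub_apply, hreprw]
    simp only [← hq] at hn
    have hnonneg : (0 : ℝ) ≤ ht q := by
      rw [hht]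
      exact sum_nonneg fun i _ => (hn i).1.1
    have hlt : (ht q : ℝ) < m := by
      rw [hht]
      calc ∑ i, b.repr (emb q) i < ∑ _i : κ, (1 : ℝ) :=
            sum_lt_sum (fun i _ => (hn i).2.1) ⟨j, mem_univ j, (hn j).2.2 hj⟩
        _ = m := by simp [hm]
    obtain ⟨k, hk⟩ := Int.eq_ofNat_of_zero_le (show 0 ≤ ht q by exact_mod_cast hnonneg)
    have hkm : k < m := by
      rw [hk] at hlt
      exact_mod_cast hlt
    refine ⟨⟨k, q, n⟩, ?_, by simp [q]⟩
    simp only [coe_sigma, Set.mem_sigma_iff, coe_product, Set.mem_prod, mem_coe, mem_box,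
      mem_tails, mem_range]
    refine ⟨hkm, ⟨⟨hk, fun i => (hn i).1⟩, fun i => (hn i).2⟩, ?_⟩
    have h : ht q = t - ∑ i, (n i : ℤ) := by simp [q, hp.1, htw]
    rw [hk] at h
    zify
    linarith

end Counting
section LatticePolytope

variable {d : ℕ}

/-- The inclusion of the lattice `ℤ^d × ℤ` into `ℝ^d × ℝ`. -/
def latticeEmb (d : ℕ) : (Fin d → ℤ) × ℤ →+ (Fin d → ℝ) × ℝ where
  toFun p := (fun i => (p.1 i : ℝ), (p.2 : ℝ))
  map_zero' := by ext <;> simp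
  map_add' p q := by ext <;> simp

theorem latticeEmb_apply (p : (Fin d → ℤ) × ℤ) :
    latticeEmb d p = (fun i => (p.1 i : ℝ), (p.2 : ℝ)) := rfl

theorem latticeEmb_injective : Function.Injective (latticeEmb d) := by
  intro p q h
  simp only [latticeEmb_apply, Prod.mk.injEq, funext_iff, Int.cast_inj] at h
  exact Prod.ext (funext h.1) h.2

/-- The lattice points at height `t` in the cone over `V × {1}`. -/
def latticeCone (V : Finset (Fin d → ℤ)) (t : ℤ) : Set ((Fin d → ℤ) × ℤ) :=
  {p | p.2 = t ∧ ∃ c : V → ℝ, (∀ i, 0 ≤ c i) ∧ ∑ i, c i • latticeEmb d (i, 1) = latticeEmb d p}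

theorem latticeCone_finite (V : Finset (Fin d → ℤ)) (t : ℤ) : (latticeCone V t).Finite := by
  let M : Fin d → ℤ := fun j => t * ∑ v : V, |(v : Fin d → ℤ) j|
  refine ((Set.finite_Icc (-M) M).prod (Set.finite_singleton t)).subset ?_
  rintro ⟨x, s⟩ ⟨rfl : s = t, c, hc, hx⟩
  simp only [latticeEmb_apply, Prod.ext_iff, Prod.fst_sum, Prod.snd_sum, Prod.smul_fst,
    Prod.smul_snd, funext_iff, Finset.sum_apply, Pi.smul_apply, smul_eq_mul, Int.cast_one,
    mul_one] at hx
  have hle : ∀ v, c v ≤ s := fun v => hx.2 ▸ single_le_sum (fun i _ => hc i) (mem_univ v)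
  have hM : ∀ j, |x j| ≤ M j := fun j => by
    have h : |(x j : ℝ)| ≤ M j := by
      rw [← hx.1 j]
      refine (abs_sum_le_sum_abs _ _).trans ?_
      simp only [M, Int.cast_mul, Int.cast_sum, Int.cast_abs, mul_sum, abs_mul]
      exact sum_le_sum fun v _ => by
        rw [abs_of_nonneg (hc v)]
        exact mul_le_mul_of_nonneg_right (hle v) (abs_nonneg _)
    exact_mod_cast h
  exact ⟨⟨fun j => (abs_le.1 (hM j)).1, fun j => (abs_le.1 (hM j)).2⟩, rfl⟩

theorem latticeCone_zero (V : Finset (Fin d → ℤ)) : latticeCone V 0 = {0} := by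
  ext ⟨x, s⟩
  simp only [latticeCone, Set.mem_ofPred_eq, Set.mem_singleton_iff]
  constructor
  · rintro ⟨rfl, c, hc, hx⟩
    have h := congrArg Prod.snd hx
    simp only [latticeEmb_apply, Prod.snd_sum, Prod.smul_snd, smul_eq_mul, Int.cast_one, mul_one,
      Int.cast_zero] at h
    have hc0 := (sum_eq_zero_iff_of_nonneg fun i _ => hc i).1 h
    refine latticeEmb_injective ?_
    rw [← hx, map_zero]
    exact sum_eq_zero fun i hi => by rw [hc0 i hi, zero_smul]
  · intro h
    exact ⟨congrArg Prod.snd h, 0, fun _ => le_rfl, by simp [h]⟩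

theorem span_latticeEmb_eq_top (V : Finset (Fin d → ℤ))
    (h : affineSpan ℝ ((fun v : Fin d → ℤ => fun i => (v i : ℝ)) '' V) = ⊤) :
    Submodule.span ℝ (Set.range fun i : V => latticeEmb d (i, 1)) = ⊤ := by
  set W := Submodule.span ℝ (Set.range fun i : V => latticeEmb d (i, 1))
  have hmem : ∀ x : Fin d → ℝ, (x, (1 : ℝ)) ∈ W := by
    intro x
    have hx : x ∈ affineSpan ℝ ((fun v : Fin d → ℤ => fun i => (v i : ℝ)) '' V) := h ▸ trivial
    refine affineSpan_induction (p := fun x => (x, (1 : ℝ)) ∈ W) hx ?_ ?_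
    · rintro _ ⟨v, hv, rfl⟩
      exact Submodule.subset_span ⟨⟨v, hv⟩, by simp [latticeEmb_apply]⟩
    · intro c u v w hu hv hw
      convert! W.add_mem (W.smul_mem c (W.sub_mem hu hv)) hw using 1
      simp
  rw [eq_top_iff]
  rintro ⟨x, s⟩ -
  convert! W.add_mem (W.sub_mem (hmem x) (hmem 0)) (W.smul_mem s (hmem 0)) using 1
  simp

theorem ncard_latticePoints_smul (V : Finset (Fin d → ℤ)) {t : ℕ} (ht : 0 < t) :
    {x : Fin d → ℤ | (fun i => (x i : ℝ)) ∈
      (t : ℝ) • convexHull ℝ ((fun v : Fin d → ℤ => fun i => (v i : ℝ)) '' V)}.ncard =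
      (latticeCone V t).ncard := by
  classical
  have hinj : Function.Injective fun x : Fin d → ℤ => (x, (t : ℤ)) :=
    fun x y h => congrArg Prod.fst h
  rw [← Set.ncard_image_of_injective _ hinj]
  congr 1
  have ht' : (0 : ℝ) < t := by exact_mod_cast ht
  have hcast : Function.Injective fun v : Fin d → ℤ => fun i => (v i : ℝ) := fun v w h =>
    funext fun i => by simpa using congrFun h i
  have key : ∀ x : Fin d → ℤ, (fun i => (x i : ℝ)) ∈
      (t : ℝ) • convexHull ℝ ((fun v : Fin d → ℤ => fun i => (v i : ℝ)) '' V) ↔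
      (x, (t : ℤ)) ∈ latticeCone V t := by
    intro x
    rw [Set.mem_smul_set_iff_inv_smul_mem₀ ht'.ne', ← coe_image, Finset.mem_convexHull']
    simp only [latticeCone, Set.mem_ofPred_eq, true_and, sum_image hcast.injOn,
      forall_mem_image]
    constructor
    · rintro ⟨c, hc, hc1, hx⟩
      refine ⟨fun v => t * c (fun i => ((v : Fin d → ℤ) i : ℝ)),
        fun v => mul_nonneg ht'.le (hc v.2), ?_⟩
      rw [← sum_coe_sort] at hc1 hx
      rw [eq_inv_smul_iff₀ ht'.ne'] at hx
      ext j
      · simpa [latticeEmb_apply, Prod.fst_sum, mul_sum, mul_assoc] using congrFun hx j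
      · simp [latticeEmb_apply, Prod.snd_sum, ← mul_sum, -univ_eq_attach, hc1]
    · rintro ⟨c, hc, hx⟩
      let c' : (Fin d → ℝ) → ℝ := Function.extend
        (fun v : V => fun i => ((v : Fin d → ℤ) i : ℝ)) (fun v => (t : ℝ)⁻¹ * c v) 0
      have hc' : ∀ v : V, c' (fun i => ((v : Fin d → ℤ) i : ℝ)) = (t : ℝ)⁻¹ * c v :=
        (hcast.comp Subtype.val_injective).extend_apply _ _
      simp only [latticeEmb_apply, Prod.ext_iff, Prod.fst_sum, Prod.snd_sum, Prod.smul_fst,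
        Prod.smul_snd, smul_eq_mul, Int.cast_one, mul_one] at hx
      refine ⟨c', fun v hv => ?_, ?_, ?_⟩
      · rw [hc' ⟨v, hv⟩]
        exact mul_nonneg (inv_nonneg.2 ht'.le) (hc _)
      · rw [← sum_coe_sort]
        simp only [hc', ← mul_sum, hx.2]
        simp [ht'.ne']
      · rw [← sum_coe_sort]
        simp only [hc', mul_smul, ← smul_sum]
        rw [← hx.1]
  ext ⟨x, s⟩
  simp only [Set.mem_image, Set.mem_ofPred_eq, key, Prod.mk.injEq]
  constructor
  · rintro ⟨y, hy, rfl, rfl⟩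
    exact hy
  · rintro h
    obtain rfl : s = t := h.1
    exact ⟨x, h, rfl, rfl⟩

theorem exists_ncard_latticeCone_eq (V : Finset (Fin d → ℤ)) (hV : V.Nonempty)
    (hspan : Submodule.span ℝ (Set.range fun i : V => latticeEmb d (i, 1)) = ⊤) :
    ∃ h : ℕ → ℕ, ∀ t : ℕ, (latticeCone V t).ncard =
      ∑ k ∈ range (d + 1), h k * (t + d - k).choose d := by
  classical
  have : Nonempty V := hV.to_subtype
  let v : V → (Fin d → ℝ) × ℝ := fun i => latticeEmb d (i, 1)
  let ht : (Fin d → ℝ) × ℝ →ₗ[ℝ] ℝ := LinearMap.snd ℝ _ _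
  have hht : ∀ i, ht (v i) = 1 := fun i => by simp [ht, v, latticeEmb_apply]
  obtain ⟨T, A, hA, hT⟩ := exists_halfOpen_partition (v := v) hspan hht
  let C : Cell v → ℤ → Set ((Fin d → ℤ) × ℤ) := fun σ t =>
    halfOpenCone σ.basis (latticeEmb d) (AddMonoidHom.snd _ _) (A σ) t
  have hsub : ∀ σ t, C σ t ⊆ latticeCone V t := by
    rintro σ t p ⟨hp, hp'⟩
    refine ⟨hp, fun i => if hi : i ∈ σ.1 then σ.basis.repr (latticeEmb d p) ⟨i, hi⟩ else 0,
      fun i => ?_, ?_⟩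
    · dsimp only
      split_ifs
      exacts [(hp' _).1, le_rfl]
    · conv_rhs => rw [← σ.sum_repr (latticeEmb d p)]
      rw [← sum_subset (subset_univ σ.1) (fun i _ hi => by simp [hi]), ← sum_coe_sort]
      simp [v]
  have hfin : ∀ σ t, (C σ t).Finite := fun σ t => (latticeCone_finite V t).subset (hsub σ t)
  have hcell : ∀ σ : Cell v, ∃ h : ℕ → ℕ, ∀ t : ℕ, (C σ t).ncard =
      ∑ k ∈ range (d + 1), h k * (t + d - k).choose d := by
    intro σ
    have hcard : Fintype.card σ.1 = d + 1 := by
      rw [← finrank_eq_card_basis σ.basis]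
      simp
    have h := ncard_halfOpenCone σ.basis (latticeEmb d)
      (AddMonoidHom.snd _ _) (fun u : σ.1 => ((u : V), 1)) (fun u => by simp [v])
      (fun p => by
        have := congrArg ht (σ.sum_repr (latticeEmb d p))
        simp only [map_sum ht, map_smul, hht, smul_eq_mul, mul_one] at this
        rw [this]
        simp [ht, latticeEmb_apply]) (hA σ) (hfin σ)
    rwa [hcard] at h
  choose h hh using hcell
  have : Fintype (Cell v) := Fintype.ofFinite _
  refine ⟨fun k => ∑ σ with σ ∈ T, h σ k, fun t => ?_⟩
  have hS := latticeCone_finite V t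
  have hone : ∀ p ∈ hS.toFinset, #(bipartiteAbove (fun p σ => p ∈ C σ t)
      ({σ | σ ∈ T} : Finset (Cell v)) p) = 1 := by
    intro p hp
    obtain ⟨hpt, c, hc, hpc⟩ := hS.mem_toFinset.1 hp
    obtain ⟨σ, hσ, huniq⟩ := hT c hc
    simp only [v, hpc] at hσ huniq
    refine card_eq_one.2 ⟨σ, ?_⟩
    ext τ
    simp only [mem_bipartiteAbove, mem_filter, mem_univ, true_and, mem_singleton]
    constructor
    · rintro ⟨hτ, hp⟩
      exact huniq τ ⟨hτ, hp.2⟩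
    · rintro rfl
      exact ⟨hσ.1, hpt, hσ.2⟩
  have hcount : ∀ σ, #(bipartiteBelow (fun p σ => p ∈ C σ t) hS.toFinset σ) = (C σ t).ncard := by
    intro σ
    rw [← Set.ncard_coe_finset]
    congr 1
    ext p
    simp only [coe_bipartiteBelow, Set.mem_ofPred_eq, Set.Finite.mem_toFinset]
    exact ⟨fun h => h.2, fun h => ⟨hsub σ t h, h⟩⟩
  calc (latticeCone V t).ncard = #hS.toFinset := Set.ncard_eq_toFinset_card _ hS
    _ = ∑ p ∈ hS.toFinset, #(bipartiteAbove (fun p σ => p ∈ C σ t)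
          ({σ | σ ∈ T} : Finset (Cell v)) p) := by rw [sum_congr rfl hone]; simp
    _ = ∑ σ with σ ∈ T, (C σ t).ncard := by
        rw [sum_card_bipartiteAbove_eq_sum_card_bipartiteBelow]
        exact sum_congr rfl fun σ _ => hcount σ
    _ = _ := by
        simp only [hh, sum_mul]
        exact sum_comm

end LatticePolytope

end Ehrhart

/-- **Stanley nonnegativity / Ehrhart in the binomial basis.**
For a `d`-dimensional convex lattice polytope `P ⊂ ℝ^d` there are nonnegative integers
`h₁, …, h_d` such that for every positive integer `t` the number of lattice points in
`t • P` equals `C(t+d, d) + h₁ C(t+d-1, d) + ⋯ + h_d C(t, d)`. -/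
theorem ehrhart_eq_binomial_basis_with_nonneg_coeffs
    (d : ℕ) (V : Finset (Fin d → ℤ)) (hV : V.Nonempty)
    (P : Set (Fin d → ℝ))
    (hP : P = convexHull ℝ ((fun v : Fin d → ℤ => fun i => (v i : ℝ)) '' V))
    (hdim : affineSpan ℝ P = ⊤) :
    ∃ h : Fin d → ℕ, ∀ t : ℕ, 0 < t →
      {x : Fin d → ℤ | (fun i => (x i : ℝ)) ∈ (t : ℝ) • P}.ncard
        = (t + d).choose d + ∑ i : Fin d, h i * (t + d - ((i : ℕ) + 1)).choose d := by
  subst hP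
  rw [affineSpan_convexHull] at hdim
  obtain ⟨h, hh⟩ := Ehrhart.exists_ncard_latticeCone_eq V hV (Ehrhart.span_latticeEmb_eq_top V hdim)
  have h0 : h 0 = 1 := by
    have h1 := hh 0
    rw [Nat.cast_zero, Ehrhart.latticeCone_zero, Set.ncard_singleton, Finset.sum_range_succ',
      Finset.sum_eq_zero fun k hk => by
        rw [Nat.choose_eq_zero_of_lt (by have := Finset.mem_range.1 hk; omega), mul_zero]] at h1
    simpa using h1.symm
  refine ⟨fun i => h (i + 1), fun t ht => ?_⟩
  rw [Ehrhart.ncard_latticePoints_smul V ht, hh, Finset.sum_range_succ', h0, add_comm,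
    Finset.sum_range]
  simp
end
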